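/- Let F = {g_1,...,g_r} ∪ {f_1,...,f_n} ⊂ C[x_1,...,x_n] where each f_i has leading monomial x_i^{d_i} (d_i ≥ 1) under DRL and deg_{x_i}(g_j) < d_i for all i, j, and let d = max_i deg(g_i). Then the complete solving degree of F is at most d - 2n + 2·Σ_{i=1}^n d_i; that is, for every element g of the reduced DRL Gröbner basis of (F) and every monomial m with deg(mg) ≤ d - 2n + 2Σ_i d_i, one can write mg = Σ_k p_k f_k + Σ_l q_l g_l with each deg(p_k f_k) and deg(q_l g_l) at most d - 2n + 2Σ_i d_i. -/

import Mathlib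

open MvPolynomial

/-- Degree reverse lexicographic order (for `x_1 > ⋯ > x_n`): `a < b` iff `a` has smaller
total degree, or degrees are equal and at the largest index where they differ, `a` has the
larger exponent. -/
def DrlLt {n : ℕ} (a b : Fin n →₀ ℕ) : Prop :=
  (∑ i, a i) < (∑ i, b i) ∨
    ((∑ i, a i) = (∑ i, b i) ∧
      ∃ i : Fin n, b i < a i ∧ ∀ j : Fin n, i < j → a j = b j)

/-- `m` is the leading monomial of `f` with respect to the DRL ordering. -/
def IsLeadingMonomial {n : ℕ} (f : MvPolynomial (Fin n) ℂ) (m : Fin n →₀ ℕ) : Prop :=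
  m ∈ f.support ∧ ∀ m' ∈ f.support, m' ≠ m → DrlLt m' m

/-- `G` is a Gröbner basis of the ideal `I` with respect to the DRL ordering. -/
def IsGB {n : ℕ} (I : Ideal (MvPolynomial (Fin n) ℂ))
    (G : Finset (MvPolynomial (Fin n) ℂ)) : Prop :=
  (G : Set (MvPolynomial (Fin n) ℂ)) ⊆ I ∧
  Ideal.span (G : Set (MvPolynomial (Fin n) ℂ)) = I ∧
  ∀ f ∈ I, f ≠ (0 : MvPolynomial (Fin n) ℂ) →
    ∃ g ∈ G, ∃ mg mf : Fin n →₀ ℕ,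
      IsLeadingMonomial g mg ∧ IsLeadingMonomial f mf ∧ ∀ i, mg i ≤ mf i

/-- `G` is the reduced Gröbner basis of `I` for the DRL ordering: a Gröbner basis whose
elements are monic and no monomial of an element is divisible by the leading monomial of
another element. -/
def IsReducedGB {n : ℕ} (I : Ideal (MvPolynomial (Fin n) ℂ))
    (G : Finset (MvPolynomial (Fin n) ℂ)) : Prop :=
  IsGB I G ∧
  ∀ g ∈ G, ∃ mg : Fin n →₀ ℕ, IsLeadingMonomial g mg ∧ g.coeff mg = 1 ∧
    ∀ m ∈ g.support, ∀ g' ∈ G, g' ≠ g → ∀ mg' : Fin n →₀ ℕ,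
      IsLeadingMonomial g' mg' → ¬ ∀ i, mg' i ≤ m i

namespace CSD

/-- Partial-sum key: the DRL order is the colexicographic order of partial sums. -/
def key {n : ℕ} (a : Fin n →₀ ℕ) : Colex (Fin (n + 1) → ℕ) :=
  toColex fun j => ∑ t, if t.val < j.val then a t else 0

lemma key_add {n : ℕ} (a b : Fin n →₀ ℕ) (j : Fin (n + 1)) :
    key (a + b) j = key a j + key b j := by
  simp only [key, Pi.toColex_apply, ← Finset.sum_add_distrib]
  refine Finset.sum_congr rfl fun t _ => ?_
  split_ifs <;> simp

lemma key_last {n : ℕ} (a : Fin n →₀ ℕ) : key a (Fin.last n) = ∑ i, a i := by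
  simp [key]

lemma key_succ {n : ℕ} (a : Fin n →₀ ℕ) (i : Fin n) :
    key a i.succ = key a i.castSucc + a i := by
  have h : a i = ∑ t, if t = i then a t else 0 := by simp
  rw [h]
  simp only [key, Pi.toColex_apply, ← Finset.sum_add_distrib]
  refine Finset.sum_congr rfl fun t _ => ?_
  simp only [Fin.val_succ, Fin.val_castSucc, Fin.ext_iff]
  split_ifs <;> first | omega | simp

lemma key_injective {n : ℕ} : Function.Injective (key (n := n)) := by
  intro a b h
  ext i
  have h1 := key_succ a i
  have h2 := key_succ b i
  rw [h] at h1
  omega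

lemma key_lt_iff {n : ℕ} (a b : Fin n →₀ ℕ) :
    key a < key b ↔ ∃ i, (∀ j, i < j → key a j = key b j) ∧ key a i < key b i :=
  Iff.rfl

lemma key_add_lt {n : ℕ} {a b : Fin n →₀ ℕ} (c : Fin n →₀ ℕ) (h : key a < key b) :
    key (c + a) < key (c + b) := by
  rw [key_lt_iff] at h ⊢
  obtain ⟨i, h1, h2⟩ := h
  exact ⟨i, fun j hj => by rw [key_add, key_add, h1 j hj], by rw [key_add, key_add]; omega⟩

lemma key_lt_of_drl {n : ℕ} {a b : Fin n →₀ ℕ} (h : DrlLt a b) : key a < key b := by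
  rw [key_lt_iff]
  rcases h with h | ⟨h, i, hi, hj⟩
  · refine ⟨Fin.last n, fun j hj => ?_, by rwa [key_last, key_last]⟩
    exact absurd (Fin.le_last j) (not_le.mpr hj)
  · have key_eq : ∀ j : Fin (n + 1), i.castSucc < j → key a j = key b j := by
      intro j
      induction j using Fin.reverseInduction with
      | last => intro _; rw [key_last, key_last, h]
      | cast j ih =>
        intro hlt
        have h1 := key_succ a j
        have h2 := key_succ b j
        have h3 : i < j := by simpa using hlt
        have h4 := ih (by simp only [Fin.lt_def, Fin.val_succ, Fin.val_castSucc] at *; omega)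
        have h5 := hj j h3
        omega
    refine ⟨i.castSucc, key_eq, ?_⟩
    have h1 := key_succ a i
    have h2 := key_succ b i
    have h3 := key_eq i.succ (by simp [Fin.lt_def])
    omega

lemma key_le_deg {n : ℕ} {a b : Fin n →₀ ℕ} (h : key a ≤ key b) : ∑ i, a i ≤ ∑ i, b i := by
  rcases h.eq_or_lt with h | h
  · rw [key_injective h]
  · obtain ⟨i, h1, h2⟩ := (key_lt_iff a b).1 h
    rw [← key_last, ← key_last]
    rcases (Fin.le_last i).eq_or_lt with h | h
    · rw [← h]; exact h2.le
    · exact (h1 _ h).le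

lemma key_wf {n : ℕ} : WellFounded fun a b : Fin n →₀ ℕ => key a < key b :=
  InvImage.wf key (wellFounded_lt (α := Colex (Fin (n + 1) → ℕ)))

variable {n : ℕ} (f : Fin n → MvPolynomial (Fin n) ℂ) (d : Fin n → ℕ)

lemma monomial_mul_eq (u : Fin n →₀ ℕ) (p q : MvPolynomial (Fin n) ℂ) :
    monomial u 1 * p * q = ∑ s ∈ p.support, p.coeff s • (monomial (u + s) 1 * q) := by
  conv_lhs => rw [p.as_sum]
  rw [Finset.mul_sum, Finset.sum_mul]
  refine Finset.sum_congr rfl fun s _ => ?_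
  rw [monomial_mul, one_mul, ← smul_mul_assoc, smul_monomial, smul_eq_mul, mul_one]

/-- If every term of `x^u p q` except the one from `s₀` lies in `W` and the total does,
so does the one from `s₀`. -/
lemma mem_of_sum (W : Submodule ℂ (MvPolynomial (Fin n) ℂ)) (u s₀ : Fin n →₀ ℕ)
    (p q : MvPolynomial (Fin n) ℂ) (h0 : s₀ ∈ p.support)
    (htot : monomial u 1 * p * q ∈ W)
    (h : ∀ s ∈ p.support, s ≠ s₀ → monomial (u + s) 1 * q ∈ W) :
    monomial (u + s₀) 1 * q ∈ W := by
  rw [monomial_mul_eq, ← Finset.add_sum_erase _ _ h0] at htot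
  have h2 : ∑ s ∈ p.support.erase s₀, p.coeff s • (monomial (u + s) 1 * q) ∈ W := by
    refine W.sum_mem fun s hs => W.smul_mem _ ?_
    rw [Finset.mem_erase] at hs
    exact h s hs.2 hs.1
  have h3 := (W.add_mem_iff_left h2).1 htot
  exact (W.smul_mem_iff (mem_support_iff.1 h0)).1 h3

/-- The good pairs. -/
def Good (t : (Fin n →₀ ℕ) × Fin n) : Prop := ∀ i < t.2, t.1 i < d i

/-- The span of good multiples. -/
noncomputable def W : Submodule ℂ (MvPolynomial (Fin n) ℂ) :=
  Submodule.span ℂ ((fun t : (Fin n →₀ ℕ) × Fin n => monomial t.1 (1:ℂ) * f t.2) ''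
    {t | Good d t})

variable {f d}

lemma split_off {u : Fin n →₀ ℕ} {j : Fin n} {e : ℕ} (h : e ≤ u j) :
    ∃ u', u = u' + Finsupp.single j e :=
  ⟨u - Finsupp.single j e, (tsub_add_cancel_of_le (by simpa using h)).symm⟩

lemma mem_W (hlm : ∀ i, IsLeadingMonomial (f i) (Finsupp.single i (d i))) :
    ∀ (M : Fin n →₀ ℕ) (k : Fin n) (u : Fin n →₀ ℕ), u + Finsupp.single k (d k) = M →
      monomial u (1:ℂ) * f k ∈ W f d := by
  intro M
  induction M using key_wf.induction with
  | _ M ihM =>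
  intro k
  induction k using WellFoundedLT.induction with
  | _ k ihk =>
  intro u hu
  by_cases hg : Good d (u, k)
  · exact Submodule.subset_span ⟨(u, k), hg, rfl⟩
  · simp only [Good, not_forall, not_lt] at hg
    obtain ⟨j, hjk, hj⟩ := hg
    obtain ⟨u, rfl⟩ := split_off hj
    refine mem_of_sum _ u _ (f j) (f k) (hlm j).1 ?_ ?_
    · rw [mul_right_comm, monomial_mul_eq]
      refine Submodule.sum_mem _ fun s hs => Submodule.smul_mem _ _ ?_
      by_cases hsk : s = Finsupp.single k (d k)
      · exact ihk j hjk _ (by rw [hsk, ← hu]; abel)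
      · refine ihM _ ?_ j _ rfl
        have := key_add_lt (u + Finsupp.single j (d j)) (key_lt_of_drl ((hlm k).2 s hs hsk))
        rw [hu] at this
        rwa [add_right_comm]
    · intro s hs hsj
      refine ihM _ ?_ k _ rfl
      have := key_add_lt (u + Finsupp.single k (d k)) (key_lt_of_drl ((hlm j).2 s hs hsj))
      rw [← hu, add_right_comm u s, add_right_comm u (Finsupp.single j (d j))]
      exact this

lemma ideal_le_W (hlm : ∀ i, IsLeadingMonomial (f i) (Finsupp.single i (d i)))
    (a : Fin n → MvPolynomial (Fin n) ℂ) : ∑ k, a k * f k ∈ W f d := by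
  refine Submodule.sum_mem _ fun k _ => ?_
  have := monomial_mul_eq 0 (a k) (f k)
  rw [show (monomial (0 : Fin n →₀ ℕ) (1:ℂ)) = 1 from rfl, one_mul] at this
  rw [this]
  exact Submodule.sum_mem _ fun s _ => Submodule.smul_mem _ _ (mem_W hlm _ k _ rfl)

lemma exists_reduced (hlm : ∀ i, IsLeadingMonomial (f i) (Finsupp.single i (d i)))
    (p : MvPolynomial (Fin n) ℂ) :
    ∃ (R : MvPolynomial (Fin n) ℂ) (a : Fin n → MvPolynomial (Fin n) ℂ), p = R + ∑ k, a k * f k ∧ ∀ m ∈ R.support, ∀ i, m i < d i := by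
  let V : Submodule ℂ (MvPolynomial (Fin n) ℂ) :=
    { carrier := {p | ∃ (R : MvPolynomial (Fin n) ℂ) (a : Fin n → MvPolynomial (Fin n) ℂ),
        p = R + ∑ k, a k * f k ∧ ∀ m ∈ R.support, ∀ i, m i < d i}
      zero_mem' := ⟨0, 0, by simp, by simp⟩
      add_mem' := by
        rintro _ _ ⟨R, a, rfl, hR⟩ ⟨R', a', rfl, hR'⟩
        refine ⟨R + R', a + a', ?_, ?_⟩
        · simp only [Pi.add_apply, add_mul, Finset.sum_add_distrib]; abel
        · intro m hm
          rcases Finset.mem_union.1 (support_add hm) with h | h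
          · exact hR m h
          · exact hR' m h
      smul_mem' := by
        rintro c _ ⟨R, a, rfl, hR⟩
        refine ⟨c • R, c • a, ?_, ?_⟩
        · simp only [Pi.smul_apply, smul_mul_assoc, smul_add, Finset.smul_sum]
        · intro m hm
          exact hR m (support_smul hm) }
  have hI : ∀ (u : Fin n →₀ ℕ) k, monomial u (1:ℂ) * f k ∈ V := by
    intro u k
    refine ⟨0, Pi.single k (monomial u 1), ?_, by simp⟩
    rw [zero_add, Finset.sum_eq_single k]
    · simp
    · intro b _ hb; simp [hb]
    · simp
  have hM : ∀ M : Fin n →₀ ℕ, monomial M (1:ℂ) ∈ V := by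
    intro M
    induction M using key_wf.induction with
    | _ M ih =>
    by_cases hg : ∀ i, M i < d i
    · refine ⟨monomial M 1, 0, by simp, ?_⟩
      intro m hm
      have := support_monomial_subset hm
      rw [Finset.mem_singleton] at this
      rwa [this]
    · simp only [not_forall, not_lt] at hg
      obtain ⟨j, hj⟩ := hg
      obtain ⟨u, rfl⟩ := split_off hj
      rw [← mul_one (monomial _ _)]
      refine mem_of_sum _ u _ (f j) 1 (hlm j).1 ?_ ?_
      · rw [mul_one]; exact hI u j
      · intro s hs hsj
        rw [mul_one]
        exact ih _ (key_add_lt u (key_lt_of_drl ((hlm j).2 s hs hsj)))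
  change p ∈ V
  have := monomial_mul_eq 0 p 1
  rw [show (monomial (0 : Fin n →₀ ℕ) (1:ℂ)) = 1 from rfl, one_mul, mul_one] at this
  rw [this]
  exact Submodule.sum_mem _ fun s _ => Submodule.smul_mem _ _ (by rw [mul_one]; exact hM _)

lemma totalDegree_le {p : MvPolynomial (Fin n) ℂ} {D : ℕ}
    (h : ∀ m ∈ p.support, ∑ i, m i ≤ D) : p.totalDegree ≤ D := by
  refine Finset.sup_le fun m hm => ?_
  rw [Finsupp.sum_fintype _ _ (fun _ => rfl)]
  exact h m hm

lemma le_deg {p : MvPolynomial (Fin n) ℂ} {m : Fin n →₀ ℕ} (hm : m ∈ p.support) :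
    ∑ i, m i ≤ p.totalDegree := by
  have := le_totalDegree hm
  rwa [Finsupp.sum_fintype _ _ (fun _ => rfl)] at this

lemma key_le_of_mem (hlm : ∀ i, IsLeadingMonomial (f i) (Finsupp.single i (d i)))
    {k : Fin n} {u N : Fin n →₀ ℕ} (h : N ∈ (monomial u (1:ℂ) * f k).support) :
    N = u + Finsupp.single k (d k) ∨ key N < key (u + Finsupp.single k (d k)) := by
  classical
  rw [mem_support_iff, coeff_monomial_mul'] at h
  split_ifs at h with hle
  · obtain ⟨s, rfl⟩ := exists_add_of_le hle
    rw [one_mul, add_tsub_cancel_left, ← mem_support_iff] at h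
    by_cases hs : s = Finsupp.single k (d k)
    · left; rw [hs]
    · right; exact key_add_lt u (key_lt_of_drl ((hlm k).2 s h hs))
  · exact absurd rfl h

lemma good_inj {t t' : (Fin n →₀ ℕ) × Fin n} (h : Good d t) (h' : Good d t')
    (he : t.1 + Finsupp.single t.2 (d t.2) = t'.1 + Finsupp.single t'.2 (d t'.2)) : t = t' := by
  have key : ∀ t t' : (Fin n →₀ ℕ) × Fin n, Good d t →
    t.1 + Finsupp.single t.2 (d t.2) = t'.1 + Finsupp.single t'.2 (d t'.2) → ¬ t'.2 < t.2 := by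
    intro t t' h he hlt
    have h1 := h _ hlt
    have h2 := DFunLike.congr_fun he t'.2
    simp [hlt.ne'] at h2
    omega
  have h2 : t.2 = t'.2 := le_antisymm (not_lt.1 (key t t' h he)) (not_lt.1 (key t' t h' he.symm))
  rw [h2] at he
  exact Prod.ext (add_right_cancel he) h2

lemma exists_rep (hlm : ∀ i, IsLeadingMonomial (f i) (Finsupp.single i (d i)))
    {p : MvPolynomial (Fin n) ℂ} (hp : p ∈ W f d) :
    ∃ a : Fin n → MvPolynomial (Fin n) ℂ, p = ∑ k, a k * f k ∧
      ∀ k, (a k * f k).totalDegree ≤ p.totalDegree := by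
  classical
  obtain ⟨c, hc, rfl⟩ := (Finsupp.mem_span_image_iff_linearCombination ℂ).1 hp
  rw [Finsupp.mem_supported] at hc
  rw [Finsupp.linearCombination_apply, Finsupp.sum]
  set p := ∑ t ∈ c.support, c t • (monomial t.1 (1:ℂ) * f t.2) with hpdef
  have hdegp : ∀ t ∈ c.support, ∑ i, (t.1 + Finsupp.single t.2 (d t.2)) i ≤ p.totalDegree := by
    intro t ht
    obtain ⟨T, hT, hmax⟩ := Finset.exists_max_image c.support
      (fun t => key (t.1 + Finsupp.single t.2 (d t.2))) ⟨t, ht⟩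
    refine (key_le_deg (hmax t ht)).trans (le_deg ?_)
    rw [mem_support_iff, hpdef, coeff_sum, Finset.sum_eq_single T]
    · rw [coeff_smul, coeff_monomial_mul, one_mul, smul_eq_mul]
      exact mul_ne_zero (Finsupp.mem_support_iff.1 hT) (mem_support_iff.1 (hlm T.2).1)
    · intro t' ht' hne
      rw [coeff_smul, smul_eq_mul]
      refine mul_eq_zero_of_right _ ?_
      by_contra hcon
      rcases key_le_of_mem hlm (mem_support_iff.2 hcon) with h | h
      · exact hne (good_inj (hc ht') (hc hT) h.symm)
      · exact absurd h (not_lt.2 (hmax t' ht'))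
    · intro h; exact absurd hT h
  refine ⟨fun k => ∑ t ∈ c.support with t.2 = k, c t • monomial t.1 (1:ℂ), ?_, ?_⟩
  · rw [hpdef, ← Finset.sum_fiberwise c.support (fun t => t.2)]
    refine Finset.sum_congr rfl fun k _ => ?_
    rw [Finset.sum_mul]
    refine Finset.sum_congr rfl fun t ht => ?_
    rw [smul_mul_assoc, (Finset.mem_filter.1 ht).2]
  · intro k
    rw [Finset.sum_mul]
    refine totalDegree_finsetSum_le fun t ht => ?_
    rw [Finset.mem_filter] at ht
    obtain ⟨ht, rfl⟩ := ht
    refine le_trans ?_ (hdegp t ht)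
    rw [smul_mul_assoc]
    refine (totalDegree_smul_le _ _).trans (totalDegree_le fun m hm => key_le_deg ?_)
    rcases key_le_of_mem hlm hm with h | h
    · rw [h]
    · exact h.le

lemma exists_coeffs {r : ℕ} {g : Fin r → MvPolynomial (Fin n) ℂ} {p : MvPolynomial (Fin n) ℂ}
    (hp : p ∈ Ideal.span (Set.range g ∪ Set.range f)) :
    ∃ (a : Fin n → MvPolynomial (Fin n) ℂ) (b : Fin r → MvPolynomial (Fin n) ℂ),
      p = (∑ k, a k * f k) + ∑ l, b l * g l := by
  rw [Ideal.span_union, Submodule.mem_sup] at hp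
  obtain ⟨y, hy, z, hz, rfl⟩ := hp
  obtain ⟨b, rfl⟩ := Ideal.mem_span_range_iff_exists_fun.1 hy
  obtain ⟨a, rfl⟩ := Ideal.mem_span_range_iff_exists_fun.1 hz
  exact ⟨a, b, add_comm _ _⟩

lemma main {r : ℕ} {g : Fin r → MvPolynomial (Fin n) ℂ}
    (hd : ∀ i, 1 ≤ d i)
    (hlm : ∀ i, IsLeadingMonomial (f i) (Finsupp.single i (d i)))
    {p : MvPolynomial (Fin n) ℂ} (hp : p ∈ Ideal.span (Set.range g ∪ Set.range f)) {D : ℕ}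
    (hpD : p.totalDegree ≤ D) (hD : ∀ l, (g l).totalDegree + ∑ i, (d i - 1) ≤ D) :
    ∃ (a : Fin n → MvPolynomial (Fin n) ℂ) (b : Fin r → MvPolynomial (Fin n) ℂ),
      p = (∑ k, a k * f k) + ∑ l, b l * g l ∧
      (∀ k, (a k * f k).totalDegree ≤ D) ∧ (∀ l, (b l * g l).totalDegree ≤ D) := by
  obtain ⟨a, b, hab⟩ := exists_coeffs hp
  choose R q hRq hR using fun l => exists_reduced hlm (b l)
  have hRD : ∀ l, (R l * g l).totalDegree ≤ D := by
    intro l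
    refine (totalDegree_mul _ _).trans (le_trans ?_ (hD l))
    rw [add_comm]
    refine Nat.add_le_add_left (totalDegree_le fun m hm => Finset.sum_le_sum fun i _ => ?_) _
    have := hR l m hm i
    omega
  have hW : p - ∑ l, R l * g l = ∑ k, (a k + ∑ l, q l k * g l) * f k := by
    have : ∑ l, b l * g l = ∑ l, R l * g l + ∑ k, (∑ l, q l k * g l) * f k := by
      simp only [Finset.sum_mul]
      rw [Finset.sum_comm, ← Finset.sum_add_distrib]
      refine Finset.sum_congr rfl fun l _ => ?_
      conv_lhs => rw [hRq l]
      rw [add_mul, Finset.sum_mul]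
      congr 1
      exact Finset.sum_congr rfl fun k _ => mul_right_comm _ _ _
    rw [hab, this]
    simp only [add_mul, Finset.sum_add_distrib]
    abel
  obtain ⟨a', ha', hdeg⟩ := exists_rep hlm (hW ▸ ideal_le_W hlm _)
  refine ⟨a', R, by rw [← ha']; abel, fun k => (hdeg k).trans ?_, hRD⟩
  refine (totalDegree_sub _ _).trans (max_le hpD (totalDegree_finsetSum_le fun l _ => hRD l))

end CSD

/-- Complete solving degree bound: for `F = {g_1,…,g_r} ∪ {f_1,…,f_n}` with
`lm(f_i) = x_i^{d_i}` (`d_i ≥ 1`) under DRL and `deg_{x_i}(g_j) < d_i`, for every element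
`h` of the reduced DRL Gröbner basis of `(F)` and every monomial `m` with
`deg(m·h) ≤ D := d - 2n + 2·Σ d_i` (`d = max_l deg(g_l)`), one can write
`m·h = Σ a_k f_k + Σ b_l g_l` with all summand degrees at most `D`. -/
theorem complete_solving_degree_bound
    (n r : ℕ) (g : Fin r → MvPolynomial (Fin n) ℂ)
    (f : Fin n → MvPolynomial (Fin n) ℂ) (d : Fin n → ℕ)
    (hd : ∀ i, 1 ≤ d i)
    (hlm : ∀ i, IsLeadingMonomial (f i) (Finsupp.single i (d i)))
    (hdeg : ∀ (i : Fin n) (j : Fin r), (g j).degreeOf i < d i) :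
    ∀ G : Finset (MvPolynomial (Fin n) ℂ),
      IsReducedGB (Ideal.span (Set.range g ∪ Set.range f)) G →
      ∀ h ∈ G, ∀ m : Fin n →₀ ℕ,
        (monomial m (1:ℂ) * h).totalDegree ≤
            (Finset.univ.sup fun l : Fin r => (g l).totalDegree) + 2 * (∑ i, d i) - 2 * n →
        ∃ (a : Fin n → MvPolynomial (Fin n) ℂ) (b : Fin r → MvPolynomial (Fin n) ℂ),
          monomial m (1:ℂ) * h = (∑ k, a k * f k) + ∑ l, b l * g l ∧
          (∀ k, (a k * f k).totalDegree ≤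
            (Finset.univ.sup fun l : Fin r => (g l).totalDegree) + 2 * (∑ i, d i) - 2 * n) ∧
          (∀ l, (b l * g l).totalDegree ≤
            (Finset.univ.sup fun l : Fin r => (g l).totalDegree) + 2 * (∑ i, d i) - 2 * n) := by
  intro G hG h hh m hdeg'
  have hsum : ∑ i, (d i - 1) + n = ∑ i, d i := by
    have : ∑ i, d i = ∑ i, ((d i - 1) + 1) :=
      Finset.sum_congr rfl fun i _ => (Nat.sub_add_cancel (hd i)).symm
    rw [this, Finset.sum_add_distrib]
    simp
  refine CSD.main hd hlm (Ideal.mul_mem_left _ _ (hG.1.1 hh)) hdeg' fun l => ?_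
  have hl := Finset.le_sup (f := fun l : Fin r => (g l).totalDegree) (Finset.mem_univ l)
  omega
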